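/- arXiv:2603.02410 — 6 statements merged into one kernel-verified Lean document; each statement's English description precedes it below -/
import Mathlib

section
/- Let p1, p2, p3 be affinely independent points in three-dimensional Euclidean space and let r1, r2, r3 ≥ 0. Define d = ‖p2 − p1‖, the unit vector u1 = (p2 − p1)/d, w = p3 − p1, u2 = (w − ⟨w,u1⟩u1)/‖w − ⟨w,u1⟩u1‖, u3 = u1 × u2 (the vector cross product), c1 = (r1² + d² − r2²)/(2d), c2 = (r1² − r3² + ⟨w,u1⟩² + ⟨w,u2⟩² − 2 c1 ⟨w,u1⟩)/(2⟨w,u2⟩), and γ = r1² − c1² − c2². If γ ≥ 0 then for either sign σ ∈ {−1, 1} the point V = p1 + c1·u1 + c2·u2 + σ√γ·u3 satisfies ‖V − p1‖ = r1, ‖V − p2‖ = r2, and ‖V − p3‖ = r3 (the three-sphere intersection/trilateration formula). -/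
open scoped RealInnerProductSpace

/-- The vector `(a, b, c)` in Euclidean 3-space. -/
noncomputable def vec3 (a b c : ℝ) : EuclideanSpace ℝ (Fin 3) :=
  (WithLp.equiv 2 (Fin 3 → ℝ)).symm ![a, b, c]

/-- The vector cross product on Euclidean 3-space. -/
noncomputable def cross3 (u v : EuclideanSpace ℝ (Fin 3)) : EuclideanSpace ℝ (Fin 3) :=
  vec3 (u 1 * v 2 - u 2 * v 1) (u 2 * v 0 - u 0 * v 2) (u 0 * v 1 - u 1 * v 0)

theorem inner_left_cross3 (u v : EuclideanSpace ℝ (Fin 3)) : ⟪u, cross3 u v⟫ = 0 := by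
  simp [cross3, vec3, PiLp.inner_apply, Fin.sum_univ_three]
  ring

theorem inner_right_cross3 (u v : EuclideanSpace ℝ (Fin 3)) : ⟪v, cross3 u v⟫ = 0 := by
  simp [cross3, vec3, PiLp.inner_apply, Fin.sum_univ_three]
  ring

/-- Lagrange's identity for the cross product. -/
theorem inner_cross3_self (u v : EuclideanSpace ℝ (Fin 3)) :
    ⟪cross3 u v, cross3 u v⟫ = ⟪u, u⟫ * ⟪v, v⟫ - ⟪u, v⟫ ^ 2 := by
  simp only [PiLp.inner_apply, Fin.sum_univ_three]
  simp [cross3, vec3]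
  ring

theorem norm_sq_combination_cross3 {u v : EuclideanSpace ℝ (Fin 3)} (hu : ⟪u, u⟫ = 1)
    (hv : ⟪v, v⟫ = 1) (huv : ⟪u, v⟫ = 0) (a b c : ℝ) :
    ‖a • u + b • v + c • cross3 u v‖ ^ 2 = a ^ 2 + b ^ 2 + c ^ 2 := by
  have h1 := inner_left_cross3 u v
  have h2 := inner_right_cross3 u v
  have h3 := inner_cross3_self u v
  rw [hu, hv, huv] at h3
  rw [← real_inner_self_eq_norm_sq]
  simp only [inner_add_left, inner_add_right, real_inner_smul_left, real_inner_smul_right,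
    real_inner_comm u v, real_inner_comm u (cross3 u v), real_inner_comm v (cross3 u v),
    hu, hv, huv, h1, h2, h3]
  ring

theorem real_inner_self_normalize {E : Type*} [NormedAddCommGroup E] [InnerProductSpace ℝ E]
    {x : E} (hx : x ≠ 0) : ⟪(1 / ‖x‖) • x, (1 / ‖x‖) • x⟫ = 1 := by
  have := norm_ne_zero_iff.2 hx
  rw [real_inner_smul_left, real_inner_smul_right, real_inner_self_eq_norm_sq]
  field_simp

/-- **Three-sphere intersection (trilateration) formula.**
Given affinely independent points `p1, p2, p3` in ℝ³ and radii `r1, r2, r3 ≥ 0`, with the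
orthonormal frame `u1, u2, u3` adapted to the triangle and the coefficients `c1, c2`,
if `γ = r1² - c1² - c2² ≥ 0` then for either sign `σ = ±1` the point
`V = p1 + c1 u1 + c2 u2 + σ √γ u3` lies at distance `r_j` from `p_j` for `j = 1,2,3`. -/
theorem three_sphere_intersection
    (p1 p2 p3 : EuclideanSpace ℝ (Fin 3))
    (hind : AffineIndependent ℝ ![p1, p2, p3])
    (r1 r2 r3 : ℝ) (hr1 : 0 ≤ r1) (hr2 : 0 ≤ r2) (hr3 : 0 ≤ r3)
    (d : ℝ) (hd : d = ‖p2 - p1‖)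
    (u1 : EuclideanSpace ℝ (Fin 3)) (hu1 : u1 = (1 / d) • (p2 - p1))
    (w : EuclideanSpace ℝ (Fin 3)) (hw : w = p3 - p1)
    (u2 : EuclideanSpace ℝ (Fin 3))
    (hu2 : u2 = (1 / ‖w - ⟪w, u1⟫ • u1‖) • (w - ⟪w, u1⟫ • u1))
    (u3 : EuclideanSpace ℝ (Fin 3)) (hu3 : u3 = cross3 u1 u2)
    (c1 : ℝ) (hc1 : c1 = (r1 ^ 2 + d ^ 2 - r2 ^ 2) / (2 * d))
    (c2 : ℝ)
    (hc2 : c2 = (r1 ^ 2 - r3 ^ 2 + ⟪w, u1⟫ ^ 2 + ⟪w, u2⟫ ^ 2 - 2 * c1 * ⟪w, u1⟫) /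
      (2 * ⟪w, u2⟫))
    (γ : ℝ) (hγ : γ = r1 ^ 2 - c1 ^ 2 - c2 ^ 2) (hγ0 : 0 ≤ γ)
    (σ : ℝ) (hσ : σ = -1 ∨ σ = 1)
    (V : EuclideanSpace ℝ (Fin 3))
    (hV : V = p1 + c1 • u1 + c2 • u2 + (σ * Real.sqrt γ) • u3) :
    ‖V - p1‖ = r1 ∧ ‖V - p2‖ = r2 ∧ ‖V - p3‖ = r3 := by
  have h12 : p2 - p1 ≠ 0 := fun h => by
    have := hind.injective.ne (show (1 : Fin 3) ≠ 0 by decide)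
    exact this (sub_eq_zero.1 h)
  have hd0 : d ≠ 0 := hd ▸ norm_ne_zero_iff.2 h12
  have hp2 : p2 - p1 = d • u1 := by
    rw [hu1, smul_smul, mul_one_div_cancel hd0, one_smul]
  have he : w - ⟪w, u1⟫ • u1 ≠ 0 := fun h => by
    rw [affineIndependent_iff_not_collinear_set] at hind
    refine hind ((collinear_iff_of_mem (p₀ := p1) (by simp)).2 ⟨u1, ?_⟩)
    simp only [Set.mem_insert_iff, Set.mem_singleton_iff, forall_eq_or_imp, forall_eq, vadd_eq_add]
    refine ⟨⟨0, by simp⟩, ⟨d, by rw [← hp2]; simp⟩, ⟨⟪w, u1⟫, ?_⟩⟩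
    rw [← sub_eq_zero.1 h, hw]
    simp
  have h11 : ⟪u1, u1⟫ = 1 := by
    rw [hu1, hd]
    exact real_inner_self_normalize h12
  have h22 : ⟪u2, u2⟫ = 1 := by
    rw [hu2]
    exact real_inner_self_normalize he
  have hu12 : ⟪u1, u2⟫ = 0 := by
    rw [hu2, real_inner_smul_right, inner_sub_right, real_inner_smul_right, h11,
      real_inner_comm u1 w]
    ring
  obtain ⟨b, hb⟩ : ∃ b, b = ‖w - ⟪w, u1⟫ • u1‖ := ⟨_, rfl⟩
  have hb0 : b ≠ 0 := hb ▸ norm_ne_zero_iff.2 he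
  have hwb : w = ⟪w, u1⟫ • u1 + b • u2 := by
    rw [hu2, ← hb, smul_smul, mul_one_div_cancel hb0, one_smul, add_sub_cancel]
  have hwu2 : ⟪w, u2⟫ = b := by
    rw [hwb, inner_add_left, real_inner_smul_left, real_inner_smul_left, hu12, h22]
    ring
  rw [hwu2] at hc2
  generalize ⟪w, u1⟫ = a at hwb hc2
  have hs : (σ * √γ) ^ 2 = r1 ^ 2 - c1 ^ 2 - c2 ^ 2 := by
    rw [mul_pow, Real.sq_sqrt hγ0, ← hγ]
    rcases hσ with rfl | rfl <;> ring
  generalize σ * √γ = s at hV hs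
  have hV1 : V - p1 = c1 • u1 + c2 • u2 + s • cross3 u1 u2 := by
    rw [hV, hu3]
    abel
  have hV2 : V - p2 = (c1 - d) • u1 + c2 • u2 + s • cross3 u1 u2 := by
    rw [← sub_sub_sub_cancel_right V p2 p1, hV1, hp2]
    module
  have hV3 : V - p3 = (c1 - a) • u1 + (c2 - b) • u2 + s • cross3 u1 u2 := by
    rw [← sub_sub_sub_cancel_right V p3 p1, hV1, ← hw, hwb]
    module
  have hc1' : 2 * d * c1 = r1 ^ 2 + d ^ 2 - r2 ^ 2 := by
    rw [hc1]
    field_simp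
  have hc2' : 2 * b * c2 = r1 ^ 2 - r3 ^ 2 + a ^ 2 + b ^ 2 - 2 * c1 * a := by
    rw [hc2]
    field_simp
  have key := norm_sq_combination_cross3 h11 h22 hu12
  refine ⟨(sq_eq_sq₀ (norm_nonneg _) hr1).1 ?_, (sq_eq_sq₀ (norm_nonneg _) hr2).1 ?_,
    (sq_eq_sq₀ (norm_nonneg _) hr3).1 ?_⟩
  · rw [hV1, key]
    linear_combination hs
  · rw [hV2, key]
    linear_combination hs - hc1'
  · rw [hV3, key]
    linear_combination hs - hc2'
end

section
/- Fix r1, r3 > 0, θ ∈ ℝ, and I > 0 with 16 I² r3² ≥ (4I² + r3² − r1²)². Define T1 = √(16 I² r3² − (4I² + r3² − r1²)²) and, for each integer N ≥ 3, T2_N = 4I² cot(π/N) + T1 sin θ and I*_N = (sin(π/N)/(4I))·√((r3² − r1²)² + T2_N²). Then I*_N converges to I as N → ∞; that is, in the large-module limit the action variable of the re-parametrization map g is conserved. -/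
/-- **Conservation of the action variable under the re-parametrization map `g` in the
large-module limit.**  The updated action `I*_N` of the connectivity map `g` of the
tubular origami model converges to `I` as the number of modules `N → ∞`. -/
theorem reparametrization_action_conserved
    (r1 r3 θ I : ℝ) (hr1 : 0 < r1) (hr3 : 0 < r3) (hI : 0 < I)
    (hdisc : (4 * I ^ 2 + r3 ^ 2 - r1 ^ 2) ^ 2 ≤ 16 * I ^ 2 * r3 ^ 2)
    (T1 : ℝ)
    (hT1 : T1 = Real.sqrt (16 * I ^ 2 * r3 ^ 2 - (4 * I ^ 2 + r3 ^ 2 - r1 ^ 2) ^ 2))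
    (T2 : ℕ → ℝ)
    (hT2 : ∀ N : ℕ, T2 N = 4 * I ^ 2 * Real.cot (Real.pi / N) + T1 * Real.sin θ)
    (Istar : ℕ → ℝ)
    (hIstar : ∀ N : ℕ, Istar N =
      Real.sin (Real.pi / N) / (4 * I) *
        Real.sqrt ((r3 ^ 2 - r1 ^ 2) ^ 2 + T2 N ^ 2)) :
    Filter.Tendsto Istar Filter.atTop (nhds I) := by
  have hx : Filter.Tendsto (fun N : ℕ => Real.pi / (N : ℝ)) Filter.atTop (nhds 0) :=
    tendsto_const_div_atTop_nhds_zero_nat Real.pi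
  have hcont : Continuous fun x : ℝ =>
      Real.sqrt ((Real.sin x * (r3 ^ 2 - r1 ^ 2)) ^ 2 +
        (4 * I ^ 2 * Real.cos x + Real.sin x * (T1 * Real.sin θ)) ^ 2) / (4 * I) := by
    fun_prop
  have hlim := (hcont.tendsto 0).comp hx
  have hval : Real.sqrt ((Real.sin 0 * (r3 ^ 2 - r1 ^ 2)) ^ 2 +
      (4 * I ^ 2 * Real.cos 0 + Real.sin 0 * (T1 * Real.sin θ)) ^ 2) / (4 * I) = I := by
    simp only [Real.sin_zero, Real.cos_zero, zero_mul, mul_one, add_zero, ne_eq,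
      OfNat.ofNat_ne_zero, not_false_eq_true, zero_pow, zero_add]
    rw [Real.sqrt_sq (by positivity)]
    field_simp
  rw [hval] at hlim
  refine hlim.congr' ?_
  filter_upwards [Filter.eventually_ge_atTop 2] with N hN
  have hN' : (2 : ℝ) ≤ N := by exact_mod_cast hN
  have hs : 0 < Real.sin (Real.pi / N) :=
    Real.sin_pos_of_pos_of_lt_pi (by positivity)
      (div_lt_self Real.pi_pos (by linarith))
  have hsq : (Real.sin (Real.pi / N) * (r3 ^ 2 - r1 ^ 2)) ^ 2 +
      (4 * I ^ 2 * Real.cos (Real.pi / N) + Real.sin (Real.pi / N) * (T1 * Real.sin θ)) ^ 2 =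
      Real.sin (Real.pi / N) ^ 2 * ((r3 ^ 2 - r1 ^ 2) ^ 2 + T2 N ^ 2) := by
    rw [hT2, Real.cot_eq_cos_div_sin]
    field_simp
  rw [Function.comp_apply, hIstar, hsq, Real.sqrt_mul (sq_nonneg _), Real.sqrt_sq hs.le]
  ring
end

section
/- Fix r1, r3 > 0, θ ∈ ℝ, and I > 0 with 16 I² r3² ≥ (4I² + r3² − r1²)², and set T1 = √(16 I² r3² − (4I² + r3² − r1²)²). For each integer N ≥ 3 define T2_N = 4I² cot(π/N) + T1 sin θ, X_{g,N} = −T1 cos θ · √((r3² − r1²)² + T2_N²), and Y_{g,N} = −sin(π/N)·( T2_N·(T1 cot(π/N) sin θ − 4I²) + (r1² − r3²)² cot(π/N) ). Then lim_{N→∞} sin(π/N)·X_{g,N} = −4I² T1 cos θ and lim_{N→∞} sin(π/N)·Y_{g,N} = −4I² T1 sin θ. Consequently, if T1 > 0, the angle θ*_N = arctan2(Y_{g,N}, X_{g,N}) satisfies (cos θ*_N, sin θ*_N) → (−cos θ, −sin θ) as N → ∞; that is, in the large-module limit the map g acts as the phase shift θ ↦ θ + π (mod 2π). -/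
/-- `arctan2 Y X` is the argument of the complex number `X + iY`. -/
noncomputable def arctan2 (y x : ℝ) : ℝ := Complex.arg (x + y * Complex.I)

open Filter Topology

/-- Multiplying both coordinates by a positive number does not change `arctan2`. -/
theorem arctan2_mul_mul {c : ℝ} (hc : 0 < c) (y x : ℝ) :
    arctan2 (c * y) (c * x) = arctan2 y x := by
  unfold arctan2
  rw [← Complex.arg_real_mul ((x : ℂ) + y * Complex.I) hc]
  congr 1
  push_cast
  ring

theorem sin_arctan2 (y x : ℝ) : Real.sin (arctan2 y x) = y / Real.sqrt (x ^ 2 + y ^ 2) := by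
  simp [arctan2, Complex.sin_arg, Complex.norm_add_mul_I]

theorem cos_arctan2 {y x : ℝ} (h : x ^ 2 + y ^ 2 ≠ 0) :
    Real.cos (arctan2 y x) = x / Real.sqrt (x ^ 2 + y ^ 2) := by
  have hz : (x : ℂ) + y * Complex.I ≠ 0 := by
    intro hz
    have hre := congrArg Complex.re hz
    have him := congrArg Complex.im hz
    simp at hre him
    simp [hre, him] at h
  simp [arctan2, Complex.cos_arg hz, Complex.norm_add_mul_I]

/-- The direction of a planar vector is continuous away from the origin. -/
theorem tendsto_cos_sin_arctan2 {ι : Type*} {l : Filter ι} {u v : ι → ℝ} {a b : ℝ}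
    (hu : Tendsto u l (𝓝 a)) (hv : Tendsto v l (𝓝 b)) (hab : 0 < a ^ 2 + b ^ 2) :
    Tendsto (fun i => (Real.cos (arctan2 (v i) (u i)), Real.sin (arctan2 (v i) (u i)))) l
      (𝓝 (a / Real.sqrt (a ^ 2 + b ^ 2), b / Real.sqrt (a ^ 2 + b ^ 2))) := by
  have hsq : Tendsto (fun i => u i ^ 2 + v i ^ 2) l (𝓝 (a ^ 2 + b ^ 2)) :=
    (hu.pow 2).add (hv.pow 2)
  have hne : Real.sqrt (a ^ 2 + b ^ 2) ≠ 0 := (Real.sqrt_pos.2 hab).ne'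
  refine ((hu.div hsq.sqrt hne).prodMk_nhds (hv.div hsq.sqrt hne)).congr' ?_
  filter_upwards [hsq.eventually_ne hab.ne'] with i hi
  simp [cos_arctan2 hi, sin_arctan2]

theorem tendsto_pi_div_natCast : Tendsto (fun N : ℕ => Real.pi / N) atTop (𝓝 0) :=
  tendsto_const_nhds.div_atTop tendsto_natCast_atTop_atTop

theorem eventually_sin_pi_div_natCast_pos :
    ∀ᶠ N : ℕ in atTop, 0 < Real.sin (Real.pi / N) := by
  filter_upwards [eventually_ge_atTop 2] with N hN
  have hN' : (1 : ℝ) < N := by exact_mod_cast hN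
  exact Real.sin_pos_of_pos_of_lt_pi (by positivity) (div_lt_self Real.pi_pos hN')

/-- **The re-parametrization map `g` acts as the phase shift `θ ↦ θ + π` in the
large-module limit.**  The normalized quantities `sin(π/N)·X_{g,N}` and `sin(π/N)·Y_{g,N}`
converge to `−4I²T1 cos θ` and `−4I²T1 sin θ` respectively, and consequently (if `T1 > 0`)
`(cos θ*_N, sin θ*_N) → (−cos θ, −sin θ)` as `N → ∞`. -/
theorem reparametrization_phase_shift
    (r1 r3 θ I : ℝ) (hr1 : 0 < r1) (hr3 : 0 < r3) (hI : 0 < I)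
    (hdisc : (4 * I ^ 2 + r3 ^ 2 - r1 ^ 2) ^ 2 ≤ 16 * I ^ 2 * r3 ^ 2)
    (T1 : ℝ)
    (hT1 : T1 = Real.sqrt (16 * I ^ 2 * r3 ^ 2 - (4 * I ^ 2 + r3 ^ 2 - r1 ^ 2) ^ 2))
    (T2 : ℕ → ℝ)
    (hT2 : ∀ N : ℕ, T2 N = 4 * I ^ 2 * Real.cot (Real.pi / N) + T1 * Real.sin θ)
    (Xg : ℕ → ℝ)
    (hXg : ∀ N : ℕ, Xg N =
      -T1 * Real.cos θ * Real.sqrt ((r3 ^ 2 - r1 ^ 2) ^ 2 + T2 N ^ 2))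
    (Yg : ℕ → ℝ)
    (hYg : ∀ N : ℕ, Yg N =
      -Real.sin (Real.pi / N) *
        (T2 N * (T1 * Real.cot (Real.pi / N) * Real.sin θ - 4 * I ^ 2) +
          (r1 ^ 2 - r3 ^ 2) ^ 2 * Real.cot (Real.pi / N)))
    (θstar : ℕ → ℝ)
    (hθstar : ∀ N : ℕ, θstar N = arctan2 (Yg N) (Xg N)) :
    Filter.Tendsto (fun N : ℕ => Real.sin (Real.pi / N) * Xg N) Filter.atTop
      (nhds (-(4 * I ^ 2) * T1 * Real.cos θ)) ∧
    Filter.Tendsto (fun N : ℕ => Real.sin (Real.pi / N) * Yg N) Filter.atTop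
      (nhds (-(4 * I ^ 2) * T1 * Real.sin θ)) ∧
    (0 < T1 →
      Filter.Tendsto (fun N : ℕ => (Real.cos (θstar N), Real.sin (θstar N))) Filter.atTop
        (nhds (-Real.cos θ, -Real.sin θ))) := by
  have hsin : Tendsto (fun N : ℕ => Real.sin (Real.pi / N)) atTop (𝓝 0) := by
    simpa [Function.comp_def] using (Real.continuous_sin.tendsto 0).comp tendsto_pi_div_natCast
  have hcos : Tendsto (fun N : ℕ => Real.cos (Real.pi / N)) atTop (𝓝 1) := by
    simpa [Function.comp_def] using (Real.continuous_cos.tendsto 0).comp tendsto_pi_div_natCast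
  have hcot : ∀ᶠ N : ℕ in atTop,
      Real.sin (Real.pi / N) * Real.cot (Real.pi / N) = Real.cos (Real.pi / N) := by
    filter_upwards [eventually_sin_pi_div_natCast_pos] with N hN
    rw [Real.cot_eq_cos_div_sin, mul_div_cancel₀ _ hN.ne']
  have hsT2 : Tendsto (fun N : ℕ => Real.sin (Real.pi / N) * T2 N) atTop (𝓝 (4 * I ^ 2)) := by
    have h := (hcos.const_mul (4 * I ^ 2)).add (hsin.mul_const (T1 * Real.sin θ))
    rw [mul_one, zero_mul, add_zero] at h
    refine h.congr' ?_
    filter_upwards [hcot] with N hN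
    rw [hT2, ← hN]
    ring
  have hX : Tendsto (fun N : ℕ => Real.sin (Real.pi / N) * Xg N) atTop
      (𝓝 (-(4 * I ^ 2) * T1 * Real.cos θ)) := by
    have h := (((hsin.pow 2).mul_const ((r3 ^ 2 - r1 ^ 2) ^ 2)).add
      (hsT2.pow 2)).sqrt.const_mul (-T1 * Real.cos θ)
    have hlim : -T1 * Real.cos θ *
        Real.sqrt (0 ^ 2 * (r3 ^ 2 - r1 ^ 2) ^ 2 + (4 * I ^ 2) ^ 2) =
        -(4 * I ^ 2) * T1 * Real.cos θ := by
      rw [zero_pow two_ne_zero, zero_mul, zero_add, Real.sqrt_sq (by positivity)]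
      ring
    rw [hlim] at h
    refine h.congr' ?_
    filter_upwards [eventually_sin_pi_div_natCast_pos] with N hN
    rw [hXg, mul_pow, ← mul_add, Real.sqrt_mul (sq_nonneg _), Real.sqrt_sq hN.le]
    ring
  have hY : Tendsto (fun N : ℕ => Real.sin (Real.pi / N) * Yg N) atTop
      (𝓝 (-(4 * I ^ 2) * T1 * Real.sin θ)) := by
    have h := ((hsT2.mul (((hcos.const_mul T1).mul_const (Real.sin θ)).sub
      (hsin.mul_const (4 * I ^ 2)))).add
      ((hsin.mul hcos).const_mul ((r1 ^ 2 - r3 ^ 2) ^ 2))).neg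
    have hlim : -(4 * I ^ 2 * (T1 * 1 * Real.sin θ - 0 * (4 * I ^ 2)) +
        (r1 ^ 2 - r3 ^ 2) ^ 2 * (0 * 1)) = -(4 * I ^ 2) * T1 * Real.sin θ := by ring
    rw [hlim] at h
    refine h.congr' ?_
    filter_upwards [hcot] with N hN
    rw [hYg, ← hN]
    ring
  refine ⟨hX, hY, fun hpos => ?_⟩
  have hK : 0 < 4 * I ^ 2 * T1 := by positivity
  have hnorm : (-(4 * I ^ 2) * T1 * Real.cos θ) ^ 2 + (-(4 * I ^ 2) * T1 * Real.sin θ) ^ 2 =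
      (4 * I ^ 2 * T1) ^ 2 := by
    linear_combination (4 * I ^ 2 * T1) ^ 2 * Real.sin_sq_add_cos_sq θ
  have h := tendsto_cos_sin_arctan2 hX hY (by rw [hnorm]; positivity)
  have hdiv (x : ℝ) : -(4 * I ^ 2) * T1 * x / (4 * I ^ 2 * T1) = -x := by
    field_simp
  rw [hnorm, Real.sqrt_sq hK.le, hdiv, hdiv] at h
  refine h.congr' ?_
  filter_upwards [eventually_sin_pi_div_natCast_pos] with N hN
  rw [arctan2_mul_mul hN, hθstar]
end

section
/- Fix l_L, l_R, r1, r2, r3 > 0 and let I > 0 satisfy β(I)² > 0 (i.e., α(I)² < 1). Then 64 I² l_L⁴ · β(I)² · γ(I) = p0(I) + p1(I) + p2(I), where p0(I) = 4 l_L² r1² (16 I² l_L² − (4I² + l_L² − l_R²)²), p1(I) = (−16 I² l_L² + (4I² + l_L² − l_R²)²)·(l_L² + r1² − r2²)², and p2(I) = −( 2 l_L² (4I² + r1² − r3²) − (4I² + l_L² − l_R²)(l_L² + r1² − r2²) )². In particular β(I)√(γ(I)) = √(P(I))/(8 I l_L²) with P = p0 + p1 + p2 wherever γ(I) ≥ 0.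 -/
/-- **Polynomial form of the irrational factor `β√γ`.**
With the auxiliary quantities of the zigzag folding map, one has
`64 I² l_L⁴ β² γ = p0 + p1 + p2`, and wherever `γ ≥ 0`,
`β √γ = √P / (8 I l_L²)` with `P = p0 + p1 + p2`. -/
theorem irrational_factor_polynomial
    (lL lR r1 r2 r3 : ℝ) (hlL : 0 < lL) (hlR : 0 < lR)
    (hr1 : 0 < r1) (hr2 : 0 < r2) (hr3 : 0 < r3)
    (I : ℝ) (hI : 0 < I)
    (α β e1 e2 γ : ℝ)
    (hα : α = (lL ^ 2 + 4 * I ^ 2 - lR ^ 2) / (4 * I * lL))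
    (hβ : β = Real.sqrt (1 - α ^ 2)) (hβpos : 0 < β ^ 2)
    (he1 : e1 = (r1 ^ 2 + lL ^ 2 - r2 ^ 2) / (2 * lL))
    (he2 : e2 = (r1 ^ 2 - r3 ^ 2 + 4 * I ^ 2 - 4 * I * e1 * α) / (4 * I * β))
    (hγ : γ = r1 ^ 2 - e1 ^ 2 - e2 ^ 2)
    (p0 p1 p2 : ℝ)
    (hp0 : p0 = 4 * lL ^ 2 * r1 ^ 2 *
      (16 * I ^ 2 * lL ^ 2 - (4 * I ^ 2 + lL ^ 2 - lR ^ 2) ^ 2))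
    (hp1 : p1 = (-(16 * I ^ 2 * lL ^ 2) + (4 * I ^ 2 + lL ^ 2 - lR ^ 2) ^ 2) *
      (lL ^ 2 + r1 ^ 2 - r2 ^ 2) ^ 2)
    (hp2 : p2 = -(2 * lL ^ 2 * (4 * I ^ 2 + r1 ^ 2 - r3 ^ 2) -
      (4 * I ^ 2 + lL ^ 2 - lR ^ 2) * (lL ^ 2 + r1 ^ 2 - r2 ^ 2)) ^ 2) :
    64 * I ^ 2 * lL ^ 4 * β ^ 2 * γ = p0 + p1 + p2 ∧
    (0 ≤ γ → β * Real.sqrt γ = Real.sqrt (p0 + p1 + p2) / (8 * I * lL ^ 2)) := by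
  have hβ0 : 0 ≤ β := hβ ▸ Real.sqrt_nonneg _
  have hβne : β ≠ 0 := fun h => by simp [h] at hβpos
  have hβsq : β ^ 2 = 1 - α ^ 2 := by
    rw [hβ] at hβpos ⊢
    exact Real.sq_sqrt (Real.sqrt_ne_zero'.mp (pow_ne_zero_iff two_ne_zero |>.mp hβpos.ne')).le
  have hα' : 4 * I ^ 2 + lL ^ 2 - lR ^ 2 = 4 * I * lL * α := by
    rw [hα]; field_simp; ring
  have he1' : lL ^ 2 + r1 ^ 2 - r2 ^ 2 = 2 * lL * e1 := by
    rw [he1]; field_simp; ring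
  have he2' : 4 * I ^ 2 + r1 ^ 2 - r3 ^ 2 = 4 * I * β * e2 + 4 * I * e1 * α := by
    rw [he2]; field_simp; ring
  have key : 64 * I ^ 2 * lL ^ 4 * β ^ 2 * γ = p0 + p1 + p2 := by
    rw [hp0, hp1, hp2, hα', he1', he2', hγ]
    linear_combination 64 * I ^ 2 * lL ^ 4 * (r1 ^ 2 - e1 ^ 2) * hβsq
  refine ⟨key, fun hγ0 => ?_⟩
  have hP : p0 + p1 + p2 = (8 * I * lL ^ 2 * β) ^ 2 * γ := by
    rw [← key]; ring
  rw [hP, Real.sqrt_mul (sq_nonneg _), Real.sqrt_sq (by positivity)]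
  field_simp
end

section
/- Fix l, r1, r2 > 0 and let I satisfy 0 < I < l (so that with l_L = l_R = l one has α(I) = I/l and β(I)² = 1 − I²/l² > 0). In the symmetric case l_L = l_R = l and r3 = r1, the irrational factor simplifies to β(I)² · γ(I) = (K1 − 4 r2² I²)/(4 l²), where K1 = −l⁴ + 2 l² (r1² + r2²) − (r1² − r2²)². In particular the polynomial under the square root in β√γ is quadratic in I. -/
/-- **Simplification of the irrational factor in the symmetric case.**
In the symmetric case `l_L = l_R = l`, `r3 = r1`, the irrational factor of the
generating-function integrand satisfies `β² γ = (K1 − 4 r2² I²)/(4 l²)` with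
`K1 = −l⁴ + 2 l² (r1² + r2²) − (r1² − r2²)²`; in particular the polynomial under the
square root in `β√γ` is quadratic in `I`. -/
theorem symmetric_case_quadratic
    (l r1 r2 : ℝ) (hl : 0 < l) (hr1 : 0 < r1) (hr2 : 0 < r2)
    (I : ℝ) (hI : 0 < I) (hIl : I < l)
    (α β e1 e2 γ : ℝ)
    (hα : α = (l ^ 2 + 4 * I ^ 2 - l ^ 2) / (4 * I * l))
    (hβ : β = Real.sqrt (1 - α ^ 2))
    (he1 : e1 = (r1 ^ 2 + l ^ 2 - r2 ^ 2) / (2 * l))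
    (he2 : e2 = (r1 ^ 2 - r1 ^ 2 + 4 * I ^ 2 - 4 * I * e1 * α) / (4 * I * β))
    (hγ : γ = r1 ^ 2 - e1 ^ 2 - e2 ^ 2)
    (K1 : ℝ)
    (hK1 : K1 = -l ^ 4 + 2 * l ^ 2 * (r1 ^ 2 + r2 ^ 2) - (r1 ^ 2 - r2 ^ 2) ^ 2) :
    β ^ 2 * γ = (K1 - 4 * r2 ^ 2 * I ^ 2) / (4 * l ^ 2) := by
  have hα' : α = I / l := by rw [hα]; field_simp; ring
  have hβ_arg : 0 < 1 - α ^ 2 := by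
    have : (I / l) ^ 2 < 1 := by
      rw [sq_lt_one_iff₀ (by positivity), div_lt_one hl]
      exact hIl
    rw [hα']; linarith
  have hβ_pos : 0 < β := hβ ▸ Real.sqrt_pos.mpr hβ_arg
  have hβ_sq : β ^ 2 = 1 - (I / l) ^ 2 := by rw [hβ, Real.sq_sqrt hβ_arg.le, hα']
  have he2β : β * e2 = I - e1 * (I / l) := by rw [he2, hα']; field_simp; ring
  calc β ^ 2 * γ = β ^ 2 * (r1 ^ 2 - e1 ^ 2) - (β * e2) ^ 2 := by rw [hγ]; ring
    _ = (K1 - 4 * r2 ^ 2 * I ^ 2) / (4 * l ^ 2) := by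
      rw [he2β, hβ_sq, he1, hK1]
      field_simp
      ring
end

section
/- (Schläfli formula for tetrahedra.) Let p0, p1, p2, p3 : ℝ → ℝ³ be continuously differentiable curves such that for every t in an open interval J the four points p0(t), p1(t), p2(t), p3(t) are affinely independent. For each of the six edges {i,j} let ℓ_{ij}(t) = ‖p_i(t) − p_j(t)‖, and let Φ_{ij}(t) denote the interior dihedral angle of the tetrahedron along the edge {i,j}, defined as the angle between the components of p_k(t) − p_i(t) and p_l(t) − p_i(t) orthogonal to p_j(t) − p_i(t), where {k,l} = {0,1,2,3} \ {i,j}. Then the angles Φ_{ij} are differentiable on J and for every t ∈ J, the sum over all six edges satisfies ∑_{i<j} ℓ_{ij}(t) · Φ_{ij}'(t) = 0. -/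
open scoped RealInnerProductSpace

/-- The component of `v` orthogonal to `w`. -/
noncomputable def perpComp (w v : EuclideanSpace ℝ (Fin 3)) : EuclideanSpace ℝ (Fin 3) :=
  v - (⟪v, w⟫ / ‖w‖ ^ 2) • w

/-- The interior dihedral angle of the tetrahedron with vertices `q 0, q 1, q 2, q 3`
along the edge `{i, j}`, where `{k, l}` is the complementary pair of indices: the angle
between the components of `q k − q i` and `q l − q i` orthogonal to `q j − q i`. -/
noncomputable def dihedral (q : Fin 4 → EuclideanSpace ℝ (Fin 3)) (i j k l : Fin 4) : ℝ :=
  InnerProductGeometry.angle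
    (perpComp (q j - q i) (q k - q i))
    (perpComp (q j - q i) (q l - q i))

/-- The interior dihedral angle along the edge `{i,j}` of the moving tetrahedron
`t ↦ (p 0 t, p 1 t, p 2 t, p 3 t)`, with `{k,l}` the complementary pair. -/
noncomputable def Φ (p : Fin 4 → ℝ → EuclideanSpace ℝ (Fin 3)) (i j k l : Fin 4)
    (t : ℝ) : ℝ :=
  dihedral (fun m => p m t) i j k l

section GramIdentities

variable {E : Type*} [NormedAddCommGroup E] [InnerProductSpace ℝ E]

/-- `‖w‖ ^ 2` times the inner product of the components of `u` and `v` orthogonal to `w`;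
in dimension three this is `⟪w × u, w × v⟫`. -/
noncomputable def perpGram (w u v : E) : ℝ :=
  ⟪u, v⟫ * ⟪w, w⟫ - ⟪u, w⟫ * ⟪v, w⟫

/-- The Gram determinant of three vectors. -/
noncomputable def gramDet (w u v : E) : ℝ :=
  ⟪w, w⟫ * ⟪u, u⟫ * ⟪v, v⟫ + 2 * ⟪w, u⟫ * ⟪u, v⟫ * ⟪w, v⟫
    - ⟪w, w⟫ * ⟪u, v⟫ ^ 2 - ⟪u, u⟫ * ⟪w, v⟫ ^ 2 - ⟪v, v⟫ * ⟪w, u⟫ ^ 2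

theorem perpGram_mul_sub_sq (w u v : E) :
    perpGram w u u * perpGram w v v - perpGram w u v ^ 2 = ‖w‖ ^ 2 * gramDet w u v := by
  simp only [perpGram, gramDet, ← real_inner_self_eq_norm_sq, real_inner_comm w u,
    real_inner_comm w v]
  ring

theorem perpGram_self_nonneg (w u : E) : 0 ≤ perpGram w u u := by
  have h := real_inner_mul_inner_self_le u w
  simp only [perpGram]
  linarith

theorem norm_pos_of_gramDet_pos {w u v : E} (h : 0 < gramDet w u v) : 0 < ‖w‖ := by
  rw [norm_pos_iff]
  rintro rfl
  simp [gramDet] at h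

theorem perpGram_self_mul_pos {w u v : E} (h : 0 < gramDet w u v) :
    0 < perpGram w u u * perpGram w v v := by
  have hw := norm_pos_of_gramDet_pos h
  have := perpGram_mul_sub_sq w u v
  have : 0 < ‖w‖ ^ 2 * gramDet w u v := by positivity
  nlinarith [sq_nonneg (perpGram w u v)]

theorem perpGram_self_pos_left {w u v : E} (h : 0 < gramDet w u v) : 0 < perpGram w u u :=
  pos_of_mul_pos_left (perpGram_self_mul_pos h) (perpGram_self_nonneg w v)

theorem perpGram_self_pos_right {w u v : E} (h : 0 < gramDet w u v) : 0 < perpGram w v v :=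
  pos_of_mul_pos_right (perpGram_self_mul_pos h) (perpGram_self_nonneg w u)

theorem gramDet_pos_of_linearIndependent {x : Fin 3 → E} (hx : LinearIndependent ℝ x) :
    0 < gramDet (x 0) (x 1) (x 2) := by
  have h := (Matrix.posDef_gram_of_linearIndependent (𝕜 := ℝ) hx).det_pos
  rw [Matrix.det_fin_three] at h
  refine h.trans_eq ?_
  simp only [gramDet, Matrix.gram_apply, real_inner_comm (x 0) (x 1), real_inner_comm (x 0) (x 2),
    real_inner_comm (x 1) (x 2)]
  ring

theorem gramDet_sub_pos_of_affineIndependent {q : Fin 4 → E} (hq : AffineIndependent ℝ q) :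
    0 < gramDet (q 1 - q 0) (q 2 - q 0) (q 3 - q 0) := by
  rw [affineIndependent_iff_linearIndependent_vsub ℝ q 0] at hq
  have hinj : Function.Injective
      (fun i : Fin 3 => (⟨i.succ, i.succ_ne_zero⟩ : {x : Fin 4 // x ≠ 0})) := fun i j h => by
    simpa using h
  exact gramDet_pos_of_linearIndependent (hq.comp _ hinj)

theorem perpGram_face (o x y z : E) :
    perpGram (x - o) (y - o) (y - o) =
      perpGram (x - o) (y - o) (z - o) + perpGram (y - o) (x - o) (z - o)
        + perpGram (y - x) (o - x) (z - x) := by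
  simp only [perpGram, inner_sub_left, inner_sub_right, real_inner_comm o x, real_inner_comm o y,
    real_inner_comm o z, real_inner_comm x y, real_inner_comm x z, real_inner_comm y z]
  ring

theorem perpGram_swap_edge (o x y z : E) :
    perpGram (o - x) (y - x) (z - x) = perpGram (x - o) (y - o) (z - o) := by
  simp only [perpGram, inner_sub_left, inner_sub_right, real_inner_comm o x, real_inner_comm o y,
    real_inner_comm o z, real_inner_comm x y, real_inner_comm x z]
  ring

theorem perpGram_comm (w u v : E) : perpGram w u v = perpGram w v u := by
  simp only [perpGram, real_inner_comm u v]
  ring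

theorem gramDet_swap_left (w u v : E) : gramDet u w v = gramDet w u v := by
  simp only [gramDet, real_inner_comm w u]
  ring

theorem gramDet_swap_right (w u v : E) : gramDet w v u = gramDet w u v := by
  simp only [gramDet, real_inner_comm u v]
  ring

theorem gramDet_swap_base (o x y z : E) :
    gramDet (o - x) (y - x) (z - x) = gramDet (x - o) (y - o) (z - o) := by
  simp only [gramDet, inner_sub_left, inner_sub_right, real_inner_comm o x, real_inner_comm o y,
    real_inner_comm o z, real_inner_comm x y, real_inner_comm x z]
  ring

end GramIdentities

theorem inner_perpComp {w : EuclideanSpace ℝ (Fin 3)} (hw : w ≠ 0)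
    (u v : EuclideanSpace ℝ (Fin 3)) :
    ⟪perpComp w u, perpComp w v⟫ = perpGram w u v / ‖w‖ ^ 2 := by
  have hw' : ‖w‖ ≠ 0 := norm_ne_zero_iff.mpr hw
  simp only [perpComp, perpGram, inner_sub_left, inner_sub_right, real_inner_smul_left,
    real_inner_smul_right, real_inner_self_eq_norm_sq w, real_inner_comm v w]
  field_simp
  ring

theorem norm_perpComp {w : EuclideanSpace ℝ (Fin 3)} (hw : w ≠ 0)
    (u : EuclideanSpace ℝ (Fin 3)) :
    ‖perpComp w u‖ = √(perpGram w u u) / ‖w‖ := by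
  rw [norm_eq_sqrt_real_inner, inner_perpComp hw, Real.sqrt_div' _ (sq_nonneg _),
    Real.sqrt_sq (norm_nonneg _)]

theorem angle_perpComp {w : EuclideanSpace ℝ (Fin 3)} (hw : w ≠ 0)
    (u v : EuclideanSpace ℝ (Fin 3)) :
    InnerProductGeometry.angle (perpComp w u) (perpComp w v) =
      Real.arccos (perpGram w u v / (√(perpGram w u u) * √(perpGram w v v))) := by
  have hw' : ‖w‖ ≠ 0 := norm_ne_zero_iff.mpr hw
  rw [InnerProductGeometry.angle, inner_perpComp hw, norm_perpComp hw, norm_perpComp hw,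
    div_mul_div_comm, ← sq, div_div_div_cancel_right₀ (pow_ne_zero 2 hw')]

theorem hasDerivAt_arccos_div_mul {g A B : ℝ → ℝ} {t g' A' B' S : ℝ}
    (hg : HasDerivAt g g' t) (hA : HasDerivAt A A' t) (hB : HasDerivAt B B' t)
    (hApos : 0 < A t) (hBpos : 0 < B t) (hS : 0 < S) (h : (A t * B t) ^ 2 - g t ^ 2 = S ^ 2) :
    HasDerivAt (fun s => Real.arccos (g s / (A s * B s)))
      (-(g' - g t * (A' / A t + B' / B t)) / S) t := by
  have hone : 1 - (g t / (A t * B t)) ^ 2 = (S / (A t * B t)) ^ 2 := by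
    field_simp
    linear_combination h
  have hlt : 0 < (S / (A t * B t)) ^ 2 := by positivity
  have hne1 : g t / (A t * B t) ≠ 1 := fun h => by rw [h] at hone; linarith
  have hne2 : g t / (A t * B t) ≠ -1 := fun h => by rw [h] at hone; linarith
  refine ((Real.hasDerivAt_arccos hne2 hne1).comp t
    (hg.fun_div (hA.fun_mul hB) (mul_pos hApos hBpos).ne')).congr_deriv ?_
  rw [hone, Real.sqrt_sq (by positivity)]
  field_simp

/-- The derivative of a dihedral angle, in terms of the derivatives of the Gram data. -/
theorem hasDerivAt_angle_perpComp {w u v : ℝ → EuclideanSpace ℝ (Fin 3)} {t D g' a' b' : ℝ}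
    (hw : ContinuousAt w t) (hD : gramDet (w t) (u t) (v t) = D) (hpos : 0 < D)
    (hg : HasDerivAt (fun s => perpGram (w s) (u s) (v s)) g' t)
    (ha : HasDerivAt (fun s => perpGram (w s) (u s) (u s)) a' t)
    (hb : HasDerivAt (fun s => perpGram (w s) (v s) (v s)) b' t) :
    HasDerivAt (fun s => InnerProductGeometry.angle (perpComp (w s) (u s)) (perpComp (w s) (v s)))
      (-(g' - perpGram (w t) (u t) (v t) / 2 * (a' / perpGram (w t) (u t) (u t)
        + b' / perpGram (w t) (v t) (v t))) / (‖w t‖ * √D)) t := by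
  subst hD
  have hw0 := norm_pos_of_gramDet_pos hpos
  have hapos := perpGram_self_pos_left hpos
  have hbpos := perpGram_self_pos_right hpos
  have hid := perpGram_mul_sub_sq (w t) (u t) (v t)
  have hev : (fun s => InnerProductGeometry.angle (perpComp (w s) (u s)) (perpComp (w s) (v s)))
      =ᶠ[nhds t] fun s => Real.arccos (perpGram (w s) (u s) (v s) /
        (√(perpGram (w s) (u s) (u s)) * √(perpGram (w s) (v s) (v s)))) := by
    filter_upwards [hw.eventually_ne (norm_pos_iff.mp hw0)] with s hs
    exact angle_perpComp hs _ _
  refine HasDerivAt.congr_of_eventuallyEq ?_ hev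
  have hApos := Real.sqrt_pos.mpr hapos
  have hBpos := Real.sqrt_pos.mpr hbpos
  have hSpos := Real.sqrt_pos.mpr hpos
  have hAsq := Real.sq_sqrt hapos.le
  have hBsq := Real.sq_sqrt hbpos.le
  refine (hasDerivAt_arccos_div_mul hg (ha.sqrt hapos.ne') (hb.sqrt hbpos.ne') hApos hBpos
    (mul_pos hw0 hSpos) ?_).congr_deriv ?_
  · rw [mul_pow, mul_pow, hAsq, hBsq, Real.sq_sqrt hpos.le, hid]
  · rw [div_div, div_div, mul_assoc, mul_assoc, ← sq, ← sq, hAsq, hBsq]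
    field_simp

/-- The Gram datum `perpGram` of the moving tetrahedron along the edge `{i, j}`. -/
noncomputable def edgeGram (p : Fin 4 → ℝ → EuclideanSpace ℝ (Fin 3)) (i j k l : Fin 4)
    (t : ℝ) : ℝ :=
  perpGram (p j t - p i t) (p k t - p i t) (p l t - p i t)

section MovingTetrahedron

variable {p : Fin 4 → ℝ → EuclideanSpace ℝ (Fin 3)} {t : ℝ}

theorem edgeGram_swap_edge (i j k l : Fin 4) : edgeGram p j i k l = edgeGram p i j k l :=
  funext fun _ => perpGram_swap_edge _ _ _ _

theorem edgeGram_swap_apex (i j k l : Fin 4) : edgeGram p i j l k = edgeGram p i j k l :=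
  funext fun _ => perpGram_comm _ _ _

theorem edgeGram_face (i j k l : Fin 4) (t : ℝ) :
    edgeGram p i j k k t = edgeGram p i j k l t + edgeGram p i k j l t + edgeGram p j k i l t :=
  perpGram_face _ _ _ _

theorem differentiableAt_edgeGram (hp : ∀ i, DifferentiableAt ℝ (p i) t) (i j k l : Fin 4) :
    DifferentiableAt ℝ (edgeGram p i j k l) t := by
  have hsub (a b : Fin 4) : DifferentiableAt ℝ (fun s => p a s - p b s) t := (hp a).sub (hp b)
  exact (((hsub k i).inner ℝ (hsub l i)).mul ((hsub j i).inner ℝ (hsub j i))).sub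
    (((hsub k i).inner ℝ (hsub j i)).mul ((hsub l i).inner ℝ (hsub j i)))

/-- The logarithmic derivative of the squared area of the face `{i, j, k}`, expressed through
the Gram data along its three edges, where `l` is the remaining vertex. -/
noncomputable def faceLogDeriv (p : Fin 4 → ℝ → EuclideanSpace ℝ (Fin 3)) (i j k l : Fin 4)
    (t : ℝ) : ℝ :=
  (deriv (edgeGram p i j k l) t + deriv (edgeGram p i k j l) t + deriv (edgeGram p j k i l) t) /
    edgeGram p i j k k t

theorem hasDerivAt_edgeGram_self (hp : ∀ i, DifferentiableAt ℝ (p i) t) (i j k l : Fin 4) :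
    HasDerivAt (edgeGram p i j k k) (deriv (edgeGram p i j k l) t +
      deriv (edgeGram p i k j l) t + deriv (edgeGram p j k i l) t) t := by
  rw [funext (edgeGram_face (p := p) i j k l)]
  exact ((differentiableAt_edgeGram hp i j k l).hasDerivAt.add
    (differentiableAt_edgeGram hp i k j l).hasDerivAt).add
    (differentiableAt_edgeGram hp j k i l).hasDerivAt

theorem hasDerivAt_Φ (hp : ∀ i, DifferentiableAt ℝ (p i) t) {i j k l : Fin 4} {D : ℝ}
    (hD : gramDet (p j t - p i t) (p k t - p i t) (p l t - p i t) = D) (hpos : 0 < D) :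
    HasDerivAt (Φ p i j k l)
      (-(deriv (edgeGram p i j k l) t - edgeGram p i j k l t / 2 *
        (faceLogDeriv p i j k l t + faceLogDeriv p i j l k t)) / (‖p j t - p i t‖ * √D)) t :=
  hasDerivAt_angle_perpComp ((hp j).sub (hp i)).continuousAt hD hpos
    (differentiableAt_edgeGram hp i j k l).hasDerivAt
    (hasDerivAt_edgeGram_self hp i j k l) (hasDerivAt_edgeGram_self hp i j l k)

theorem norm_mul_deriv_Φ (hp : ∀ i, DifferentiableAt ℝ (p i) t) {i j k l : Fin 4} {D : ℝ}
    (hD : gramDet (p j t - p i t) (p k t - p i t) (p l t - p i t) = D) (hpos : 0 < D) :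
    ‖p i t - p j t‖ * deriv (Φ p i j k l) t =
      -(deriv (edgeGram p i j k l) t - edgeGram p i j k l t / 2 *
        (faceLogDeriv p i j k l t + faceLogDeriv p i j l k t)) / √D := by
  have hw := norm_pos_of_gramDet_pos (hD ▸ hpos)
  have hS := Real.sqrt_pos.mpr hpos
  rw [(hasDerivAt_Φ hp hD hpos).deriv, norm_sub_rev]
  field_simp

theorem edgeGram_mul_faceLogDeriv {i j k l : Fin 4}
    (h : 0 < edgeGram p i j k k t) :
    (edgeGram p i j k l t + edgeGram p i k j l t + edgeGram p j k i l t) *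
      faceLogDeriv p i j k l t =
    deriv (edgeGram p i j k l) t + deriv (edgeGram p i k j l) t +
      deriv (edgeGram p j k i l) t := by
  rw [faceLogDeriv, ← edgeGram_face, mul_div_cancel₀ _ h.ne']

theorem faceLogDeriv_swap_left (i j k l : Fin 4) :
    faceLogDeriv p j i k l t = faceLogDeriv p i j k l t := by
  rw [faceLogDeriv, faceLogDeriv, edgeGram_face j i k l, edgeGram_face i j k l,
    edgeGram_swap_edge i j]
  ring

theorem faceLogDeriv_swap_right (i j k l : Fin 4) :
    faceLogDeriv p i k j l t = faceLogDeriv p i j k l t := by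
  rw [faceLogDeriv, faceLogDeriv, edgeGram_face i k j l, edgeGram_face i j k l,
    edgeGram_swap_edge j k]
  ring

end MovingTetrahedron

/-- **Schläfli formula for tetrahedra.**  If the four vertices of a tetrahedron move
along `C¹` curves and stay affinely independent on an open interval `J`, then the six
interior dihedral angles are differentiable on `J` and
`∑_{i<j} ℓ_{ij}(t) · Φ_{ij}'(t) = 0` for every `t ∈ J`, where `ℓ_{ij}` are the edge
lengths. -/
theorem schlafli_formula_tetrahedron
    (p : Fin 4 → ℝ → EuclideanSpace ℝ (Fin 3))
    (hp : ∀ i, ContDiff ℝ 1 (p i))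
    (a b : ℝ) (J : Set ℝ) (hJ : J = Set.Ioo a b)
    (hind : ∀ t ∈ J, AffineIndependent ℝ (fun i => p i t)) :
    (∀ t ∈ J,
      DifferentiableAt ℝ (Φ p 0 1 2 3) t ∧
      DifferentiableAt ℝ (Φ p 0 2 1 3) t ∧
      DifferentiableAt ℝ (Φ p 0 3 1 2) t ∧
      DifferentiableAt ℝ (Φ p 1 2 0 3) t ∧
      DifferentiableAt ℝ (Φ p 1 3 0 2) t ∧
      DifferentiableAt ℝ (Φ p 2 3 0 1) t) ∧
    (∀ t ∈ J,
      ‖p 0 t - p 1 t‖ * deriv (Φ p 0 1 2 3) t +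
      ‖p 0 t - p 2 t‖ * deriv (Φ p 0 2 1 3) t +
      ‖p 0 t - p 3 t‖ * deriv (Φ p 0 3 1 2) t +
      ‖p 1 t - p 2 t‖ * deriv (Φ p 1 2 0 3) t +
      ‖p 1 t - p 3 t‖ * deriv (Φ p 1 3 0 2) t +
      ‖p 2 t - p 3 t‖ * deriv (Φ p 2 3 0 1) t = 0) := by
  have hdiff (t : ℝ) (i : Fin 4) : DifferentiableAt ℝ (p i) t :=
    (hp i).differentiable one_ne_zero t
  have hpos (t : ℝ) (ht : t ∈ J) :
      0 < gramDet (p 1 t - p 0 t) (p 2 t - p 0 t) (p 3 t - p 0 t) :=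
    gramDet_sub_pos_of_affineIndependent (q := fun i => p i t) (hind t ht)
  have h02 (t : ℝ) : gramDet (p 2 t - p 0 t) (p 1 t - p 0 t) (p 3 t - p 0 t) =
      gramDet (p 1 t - p 0 t) (p 2 t - p 0 t) (p 3 t - p 0 t) := gramDet_swap_left _ _ _
  have h03 (t : ℝ) : gramDet (p 3 t - p 0 t) (p 1 t - p 0 t) (p 2 t - p 0 t) =
      gramDet (p 1 t - p 0 t) (p 2 t - p 0 t) (p 3 t - p 0 t) :=
    (gramDet_swap_left _ _ _).trans (gramDet_swap_right _ _ _)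
  have h12 (t : ℝ) : gramDet (p 2 t - p 1 t) (p 0 t - p 1 t) (p 3 t - p 1 t) =
      gramDet (p 1 t - p 0 t) (p 2 t - p 0 t) (p 3 t - p 0 t) :=
    (gramDet_swap_left _ _ _).trans (gramDet_swap_base _ _ _ _)
  have h13 (t : ℝ) : gramDet (p 3 t - p 1 t) (p 0 t - p 1 t) (p 2 t - p 1 t) =
      gramDet (p 1 t - p 0 t) (p 2 t - p 0 t) (p 3 t - p 0 t) :=
    (gramDet_swap_left _ _ _).trans ((gramDet_swap_right _ _ _).trans (gramDet_swap_base _ _ _ _))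
  have h23 (t : ℝ) : gramDet (p 3 t - p 2 t) (p 0 t - p 2 t) (p 1 t - p 2 t) =
      gramDet (p 1 t - p 0 t) (p 2 t - p 0 t) (p 3 t - p 0 t) :=
    (gramDet_swap_left _ _ _).trans <| (gramDet_swap_right _ _ _).trans <|
      (gramDet_swap_base _ _ _ _).trans (gramDet_swap_left _ _ _)
  refine ⟨fun t ht => ?_, fun t ht => ?_⟩
  · exact ⟨(hasDerivAt_Φ (hdiff t) rfl (hpos t ht)).differentiableAt,
      (hasDerivAt_Φ (hdiff t) (h02 t) (hpos t ht)).differentiableAt,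
      (hasDerivAt_Φ (hdiff t) (h03 t) (hpos t ht)).differentiableAt,
      (hasDerivAt_Φ (hdiff t) (h12 t) (hpos t ht)).differentiableAt,
      (hasDerivAt_Φ (hdiff t) (h13 t) (hpos t ht)).differentiableAt,
      (hasDerivAt_Φ (hdiff t) (h23 t) (hpos t ht)).differentiableAt⟩
  · have hD := hpos t ht
    have f012 := edgeGram_mul_faceLogDeriv (l := 3)
      (show 0 < edgeGram p 0 1 2 2 t from perpGram_self_pos_left hD)
    have f013 := edgeGram_mul_faceLogDeriv (l := 2)
      (show 0 < edgeGram p 0 1 3 3 t from perpGram_self_pos_right hD)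
    have f023 := edgeGram_mul_faceLogDeriv (l := 1)
      (show 0 < edgeGram p 0 2 3 3 t from perpGram_self_pos_right (hD.trans_eq (h02 t).symm))
    have f123 := edgeGram_mul_faceLogDeriv (l := 0)
      (show 0 < edgeGram p 1 2 3 3 t from perpGram_self_pos_right (hD.trans_eq (h12 t).symm))
    rw [norm_mul_deriv_Φ (hdiff t) rfl hD, norm_mul_deriv_Φ (hdiff t) (h02 t) hD,
      norm_mul_deriv_Φ (hdiff t) (h03 t) hD, norm_mul_deriv_Φ (hdiff t) (h12 t) hD,
      norm_mul_deriv_Φ (hdiff t) (h13 t) hD, norm_mul_deriv_Φ (hdiff t) (h23 t) hD]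
    rw [faceLogDeriv_swap_right 0 1 2 3, faceLogDeriv_swap_right 0 1 3 2,
      faceLogDeriv_swap_right 0 2 3 1, faceLogDeriv_swap_right 1 2 3 0,
      show faceLogDeriv p 1 2 0 3 t = faceLogDeriv p 0 1 2 3 t by
        rw [faceLogDeriv_swap_right, faceLogDeriv_swap_left],
      show faceLogDeriv p 1 3 0 2 t = faceLogDeriv p 0 1 3 2 t by
        rw [faceLogDeriv_swap_right, faceLogDeriv_swap_left],
      show faceLogDeriv p 2 3 0 1 t = faceLogDeriv p 0 2 3 1 t by
        rw [faceLogDeriv_swap_right, faceLogDeriv_swap_left],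
      show faceLogDeriv p 2 3 1 0 t = faceLogDeriv p 1 2 3 0 t by
        rw [faceLogDeriv_swap_right, faceLogDeriv_swap_left]]
    rw [edgeGram_swap_apex 0 1 2 3] at f013
    rw [edgeGram_swap_apex 0 2 1 3, edgeGram_swap_apex 0 3 1 2] at f023
    rw [edgeGram_swap_apex 1 2 0 3, edgeGram_swap_apex 1 3 0 2,
      edgeGram_swap_apex 2 3 0 1] at f123
    linear_combination (f012 + f013 + f023 + f123) / (2 * √(gramDet (p 1 t - p 0 t)
      (p 2 t - p 0 t) (p 3 t - p 0 t)))
end
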